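/- arXiv:1107.4400 — 8 statements merged into one kernel-verified Lean document; each statement's English description precedes it below -/
import Mathlib

section
/- For the Grover walk started at the origin with initial coin amplitudes (α_{0,0,0}, α_{0,0,1}, α_{0,0,2}, α_{0,0,3})(0) = (1/2, −1/2, −1/2, 1/2), for every time t ∈ ℕ and every point (x,y) ∈ ℤ² the amplitudes satisfy both relations: α_{x−1,y,0}(t) + α_{x−1,y,1}(t) + α_{x+1,y,2}(t) + α_{x+1,y,3}(t) = 0 and α_{x,y−1,0}(t) + α_{x,y−1,2}(t) + α_{x,y+1,1}(t) + α_{x,y+1,3}(t) = 0. -/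
/-- The Grover coin: `G j j = -1/2`, `G j k = 1/2` for `j ≠ k`. -/
noncomputable def groverCoin : Fin 4 → Fin 4 → ℝ :=
  fun j k => if j = k then -(1/2) else 1/2

/-- One-step evolution of the Grover walk on `ℤ²`. -/
def GroverEvol (α : ℕ → ℤ → ℤ → Fin 4 → ℝ) : Prop :=
  ∀ (t : ℕ) (x y : ℤ),
    α (t+1) x y 0 = ∑ j : Fin 4, groverCoin 0 j * α t (x+1) (y+1) j ∧
    α (t+1) x y 1 = ∑ j : Fin 4, groverCoin 1 j * α t (x+1) (y-1) j ∧
    α (t+1) x y 2 = ∑ j : Fin 4, groverCoin 2 j * α t (x-1) (y+1) j ∧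
    α (t+1) x y 3 = ∑ j : Fin 4, groverCoin 3 j * α t (x-1) (y-1) j

/-- One step of the Grover walk exchanges the two amplitude relations. -/
theorem GroverEvol.relations_succ {α : ℕ → ℤ → ℤ → Fin 4 → ℝ} (hevol : GroverEvol α) {t : ℕ}
    (h : ∀ x y : ℤ,
      α t (x-1) y 0 + α t (x-1) y 1 + α t (x+1) y 2 + α t (x+1) y 3 = 0 ∧
      α t x (y-1) 0 + α t x (y-1) 2 + α t x (y+1) 1 + α t x (y+1) 3 = 0) (x y : ℤ) :
    α (t+1) (x-1) y 0 + α (t+1) (x-1) y 1 + α (t+1) (x+1) y 2 + α (t+1) (x+1) y 3 = 0 ∧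
    α (t+1) x (y-1) 0 + α (t+1) x (y-1) 2 + α (t+1) x (y+1) 1 + α (t+1) x (y+1) 3 = 0 := by
  obtain ⟨hx, hy⟩ := h x y
  constructor
  · rw [(hevol t (x-1) y).1, (hevol t (x-1) y).2.1, (hevol t (x+1) y).2.2.1,
      (hevol t (x+1) y).2.2.2]
    simp only [Fin.sum_univ_four, groverCoin, sub_add_cancel, add_sub_cancel_right, Fin.reduceEq,
      if_true, if_false]
    linarith
  · rw [(hevol t x (y-1)).1, (hevol t x (y-1)).2.2.1, (hevol t x (y+1)).2.1,
      (hevol t x (y+1)).2.2.2]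
    simp only [Fin.sum_univ_four, groverCoin, sub_add_cancel, add_sub_cancel_right, Fin.reduceEq,
      if_true, if_false]
    linarith

/-- Lemma 1 of the paper: for the Grover walk started at the origin with initial coin
`(1/2, -1/2, -1/2, 1/2)`, the two amplitude relations hold for all times and positions. -/
theorem grover_amplitude_relations
    (α : ℕ → ℤ → ℤ → Fin 4 → ℝ)
    (hevol : GroverEvol α)
    (hinit : ∀ (x y : ℤ), (x, y) ≠ (0, 0) → ∀ j, α 0 x y j = 0)
    (h0 : α 0 0 0 0 = 1/2) (h1 : α 0 0 0 1 = -(1/2))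
    (h2 : α 0 0 0 2 = -(1/2)) (h3 : α 0 0 0 3 = 1/2) :
    ∀ (t : ℕ) (x y : ℤ),
      α t (x-1) y 0 + α t (x-1) y 1 + α t (x+1) y 2 + α t (x+1) y 3 = 0 ∧
      α t x (y-1) 0 + α t x (y-1) 2 + α t x (y+1) 1 + α t x (y+1) 3 = 0 := by
  intro t
  induction t with
  | zero =>
    have initial_cancel : ∀ x y : ℤ,
        α 0 x y 0 + α 0 x y 1 = 0 ∧ α 0 x y 2 + α 0 x y 3 = 0 ∧
        α 0 x y 0 + α 0 x y 2 = 0 ∧ α 0 x y 1 + α 0 x y 3 = 0 := by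
      intro x y
      by_cases h : (x, y) = (0, 0)
      · obtain ⟨rfl, rfl⟩ := Prod.mk.inj h
        norm_num [h0, h1, h2, h3]
      · simp [hinit x y h]
    intro x y
    constructor
    · linarith [(initial_cancel (x-1) y).1, (initial_cancel (x+1) y).2.1]
    · linarith [(initial_cancel x (y-1)).2.2.1, (initial_cancel x (y+1)).2.2.2]
  | succ t ih => exact hevol.relations_succ ih
end

section
/- For the Grover walk, if at time t the relation α_{x,y−1,0}(t) + α_{x,y−1,2}(t) + α_{x,y+1,1}(t) + α_{x,y+1,3}(t) = 0 holds for all (x,y) ∈ ℤ², then at time t+1 the relation α_{x−1,y,0}(t+1) + α_{x−1,y,1}(t+1) + α_{x+1,y,2}(t+1) + α_{x+1,y,3}(t+1) = 0 holds for all (x,y) ∈ ℤ². -/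
/-- Inductive step: if the second amplitude relation holds everywhere at time `t`, then the
first amplitude relation holds everywhere at time `t+1`. -/
theorem grover_relation_step_one
    (α : ℕ → ℤ → ℤ → Fin 4 → ℝ)
    (hevol : GroverEvol α)
    (t : ℕ)
    (h : ∀ (x y : ℤ),
      α t x (y-1) 0 + α t x (y-1) 2 + α t x (y+1) 1 + α t x (y+1) 3 = 0) :
    ∀ (x y : ℤ),
      α (t+1) (x-1) y 0 + α (t+1) (x-1) y 1 + α (t+1) (x+1) y 2 + α (t+1) (x+1) y 3 = 0 := by
  intro x y
  obtain ⟨h0, h1, -, -⟩ := hevol t (x-1) y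
  obtain ⟨-, -, h2, h3⟩ := hevol t (x+1) y
  simp only [sub_add_cancel, add_sub_cancel_right, Fin.sum_univ_four, groverCoin] at h0 h1 h2 h3
  rw [h0, h1, h2, h3]
  norm_num [Fin.ext_iff]
  linarith [h x y]
end

section
/- For the Grover walk, if at time t the relation α_{x−1,y,0}(t) + α_{x−1,y,1}(t) + α_{x+1,y,2}(t) + α_{x+1,y,3}(t) = 0 holds for all (x,y) ∈ ℤ², then at time t+1 the relation α_{x,y−1,0}(t+1) + α_{x,y−1,2}(t+1) + α_{x,y+1,1}(t+1) + α_{x,y+1,3}(t+1) = 0 holds for all (x,y) ∈ ℤ². -/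
/-- Inductive step: if the first amplitude relation holds everywhere at time `t`, then the
second amplitude relation holds everywhere at time `t+1`. -/
theorem grover_relation_step_two
    (α : ℕ → ℤ → ℤ → Fin 4 → ℝ)
    (hevol : GroverEvol α)
    (t : ℕ)
    (h : ∀ (x y : ℤ),
      α t (x-1) y 0 + α t (x-1) y 1 + α t (x+1) y 2 + α t (x+1) y 3 = 0) :
    ∀ (x y : ℤ),
      α (t+1) x (y-1) 0 + α (t+1) x (y-1) 2 + α (t+1) x (y+1) 1 + α (t+1) x (y+1) 3 = 0 := by
  intro x y
  obtain ⟨h₀, -, h₂, -⟩ := hevol t x (y - 1)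
  obtain ⟨-, h₁, -, h₃⟩ := hevol t x (y + 1)
  rw [h₀, h₁, h₂, h₃, sub_add_cancel, add_sub_cancel_right]
  simp [Fin.sum_univ_four, groverCoin]
  linarith [h x y]
end

section
/- Let α be the Grover walk amplitudes started at the origin with initial coin (1/2, −1/2, −1/2, 1/2) and let β be the alternate (Hadamard) quantum walk amplitudes started at the origin with initial coin (1/√2, i/√2). Then for every time t ∈ ℕ and every (x,y) ∈ ℤ²: β_{x,y,0}(t) = (−1)^t e^{iπ/4} [α_{x,y,0}(t) + i·α_{x,y,2}(t)] and β_{x,y,1}(t) = (−1)^t e^{iπ/4} [−α_{x,y,1}(t) + i·α_{x,y,3}(t)]. -/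
/-- One-step evolution of the alternate (Hadamard) quantum walk on `ℤ²`. -/
def AltEvol (β : ℕ → ℤ → ℤ → Fin 2 → ℂ) : Prop :=
  ∀ (t : ℕ) (x y : ℤ),
    β (t+1) x y 0 = (1/2) * (β t (x+1) (y+1) 0 + β t (x+1) (y+1) 1
      + β t (x-1) (y+1) 0 - β t (x-1) (y+1) 1) ∧
    β (t+1) x y 1 = (1/2) * (β t (x+1) (y-1) 0 + β t (x+1) (y-1) 1
      - β t (x-1) (y-1) 0 + β t (x-1) (y-1) 1)

/-- The Grover evolution with the coin sums written out. -/
theorem GroverEvol.expand {α : ℕ → ℤ → ℤ → Fin 4 → ℝ} (h : GroverEvol α) (t : ℕ) (x y : ℤ) :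
    α (t+1) x y 0 = (-α t (x+1) (y+1) 0 + α t (x+1) (y+1) 1
      + α t (x+1) (y+1) 2 + α t (x+1) (y+1) 3) / 2 ∧
    α (t+1) x y 1 = (α t (x+1) (y-1) 0 - α t (x+1) (y-1) 1
      + α t (x+1) (y-1) 2 + α t (x+1) (y-1) 3) / 2 ∧
    α (t+1) x y 2 = (α t (x-1) (y+1) 0 + α t (x-1) (y+1) 1
      - α t (x-1) (y+1) 2 + α t (x-1) (y+1) 3) / 2 ∧
    α (t+1) x y 3 = (α t (x-1) (y-1) 0 + α t (x-1) (y-1) 1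
      + α t (x-1) (y-1) 2 - α t (x-1) (y-1) 3) / 2 := by
  obtain ⟨h0, h1, h2, h3⟩ := h t x y
  rw [h0, h1, h2, h3]
  simp only [groverCoin, Fin.sum_univ_four, Fin.reduceEq, if_true, if_false]
  refine ⟨?_, ?_, ?_, ?_⟩ <;> ring

/-- The two local conservation laws of the Grover walk (horizontal and vertical) propagate
in time. -/
theorem GroverEvol.cancellation {α : ℕ → ℤ → ℤ → Fin 4 → ℝ} (h : GroverEvol α)
    (h0 : ∀ x y : ℤ,
      α 0 (x+1) y 2 + α 0 (x+1) y 3 + α 0 (x-1) y 0 + α 0 (x-1) y 1 = 0 ∧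
      α 0 x (y+1) 1 + α 0 x (y+1) 3 + α 0 x (y-1) 0 + α 0 x (y-1) 2 = 0) (t : ℕ) :
    ∀ x y : ℤ,
      α t (x+1) y 2 + α t (x+1) y 3 + α t (x-1) y 0 + α t (x-1) y 1 = 0 ∧
      α t x (y+1) 1 + α t x (y+1) 3 + α t x (y-1) 0 + α t x (y-1) 2 = 0 := by
  induction t with
  | zero => exact h0
  | succ t ih =>
    intro x y
    obtain ⟨hx, hy⟩ := ih x y
    obtain ⟨-, -, e2, e3⟩ := h.expand t (x+1) y
    obtain ⟨w0, w1, -, -⟩ := h.expand t (x-1) y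
    obtain ⟨-, n1, -, n3⟩ := h.expand t x (y+1)
    obtain ⟨s0, -, s2, -⟩ := h.expand t x (y-1)
    simp only [add_sub_cancel_right, sub_add_cancel] at e2 e3 w0 w1 n1 n3 s0 s2
    constructor <;> linarith

theorem exp_pi_mul_I_div_four :
    Complex.exp (Real.pi * Complex.I / 4) = (1 + Complex.I) / Real.sqrt 2 := by
  have hs : ((Real.sqrt 2 : ℝ) : ℂ) ^ 2 = 2 := by
    exact_mod_cast Real.sq_sqrt (show (0 : ℝ) ≤ 2 by norm_num)
  have hs0 : ((Real.sqrt 2 : ℝ) : ℂ) ≠ 0 := by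
    simp
  rw [show (Real.pi * Complex.I / 4 : ℂ) = ((Real.pi / 4 : ℝ) : ℂ) * Complex.I by
    push_cast; ring, Complex.exp_mul_I, ← Complex.ofReal_cos, ← Complex.ofReal_sin,
    Real.cos_pi_div_four, Real.sin_pi_div_four]
  push_cast
  field_simp
  linear_combination (1 + Complex.I) * hs

/-- Theorem 1 of the paper: the amplitudes of the alternate (Hadamard) walk started with coin
`(1/√2, i/√2)` are linked to the amplitudes of the Grover walk started with coin
`(1/2, -1/2, -1/2, 1/2)` by
`β_{x,y,0}(t) = (-1)^t e^{iπ/4} (α_{x,y,0}(t) + i α_{x,y,2}(t))` and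
`β_{x,y,1}(t) = (-1)^t e^{iπ/4} (-α_{x,y,1}(t) + i α_{x,y,3}(t))`. -/
theorem alternate_grover_amplitude_map
    (α : ℕ → ℤ → ℤ → Fin 4 → ℝ)
    (hαevol : GroverEvol α)
    (hαinit : ∀ (x y : ℤ), (x, y) ≠ (0, 0) → ∀ j, α 0 x y j = 0)
    (hα0 : α 0 0 0 0 = 1/2) (hα1 : α 0 0 0 1 = -(1/2))
    (hα2 : α 0 0 0 2 = -(1/2)) (hα3 : α 0 0 0 3 = 1/2)
    (β : ℕ → ℤ → ℤ → Fin 2 → ℂ)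
    (hβevol : AltEvol β)
    (hβinit : ∀ (x y : ℤ), (x, y) ≠ (0, 0) → ∀ j, β 0 x y j = 0)
    (hβ0 : β 0 0 0 0 = 1 / Real.sqrt 2)
    (hβ1 : β 0 0 0 1 = Complex.I / Real.sqrt 2) :
    ∀ (t : ℕ) (x y : ℤ),
      β t x y 0 = (-1 : ℂ)^t * Complex.exp (Real.pi * Complex.I / 4)
        * ((α t x y 0 : ℂ) + Complex.I * (α t x y 2 : ℂ)) ∧
      β t x y 1 = (-1 : ℂ)^t * Complex.exp (Real.pi * Complex.I / 4)
        * (-(α t x y 1 : ℂ) + Complex.I * (α t x y 3 : ℂ)) := by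
  have hpair : ∀ x y : ℤ, α 0 x y 0 + α 0 x y 1 = 0 ∧ α 0 x y 2 + α 0 x y 3 = 0 ∧
      α 0 x y 0 + α 0 x y 2 = 0 ∧ α 0 x y 1 + α 0 x y 3 = 0 := by
    intro x y
    by_cases hxy : (x, y) = (0, 0)
    · obtain ⟨rfl, rfl⟩ := Prod.mk.inj hxy
      rw [hα0, hα1, hα2, hα3]
      norm_num
    · simp [hαinit x y hxy]
  have hcancel := hαevol.cancellation fun x y => by
    obtain ⟨-, e, -, -⟩ := hpair (x+1) y
    obtain ⟨w, -, -, -⟩ := hpair (x-1) y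
    obtain ⟨-, -, -, n⟩ := hpair x (y+1)
    obtain ⟨-, -, s, -⟩ := hpair x (y-1)
    constructor <;> linarith
  intro t
  induction t with
  | zero =>
    intro x y
    by_cases hxy : (x, y) = (0, 0)
    · obtain ⟨rfl, rfl⟩ := Prod.mk.inj hxy
      rw [hα0, hα1, hα2, hα3, hβ0, hβ1, exp_pi_mul_I_div_four]
      push_cast
      constructor
      · linear_combination (1 / (2 * (Real.sqrt 2 : ℂ))) * Complex.I_sq
      · linear_combination (-1 / (2 * (Real.sqrt 2 : ℂ))) * Complex.I_sq
    · simp [hαinit x y hxy, hβinit x y hxy]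
  | succ t ih =>
    intro x y
    obtain ⟨b0, b1⟩ := hβevol t x y
    obtain ⟨a0, a1, a2, a3⟩ := hαevol.expand t x y
    have hn := congrArg ((↑) : ℝ → ℂ) (hcancel t x (y+1)).1
    have hs := congrArg ((↑) : ℝ → ℂ) (hcancel t x (y-1)).1
    push_cast at hn hs
    rw [b0, b1, a0, a1, a2, a3, (ih (x+1) (y+1)).1, (ih (x+1) (y+1)).2, (ih (x-1) (y+1)).1,
      (ih (x-1) (y+1)).2, (ih (x+1) (y-1)).1, (ih (x+1) (y-1)).2, (ih (x-1) (y-1)).1,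
      (ih (x-1) (y-1)).2]
    push_cast
    set c := (-1 : ℂ)^t * Complex.exp (Real.pi * Complex.I / 4) with hc
    rw [show (-1 : ℂ)^(t+1) * Complex.exp (Real.pi * Complex.I / 4) = -c by rw [hc]; ring]
    constructor
    · linear_combination c / 2 * (1 + Complex.I) * hn
    · linear_combination c / 2 * (-1 + Complex.I) * hs
end

section
/- For the generalized Grover walk started at the origin with initial coin amplitudes α_{0,0,0}(0) = α_{0,0,3}(0) = (−1)^ξ |cs|/(√2 s) and α_{0,0,1}(0) = α_{0,0,2}(0) = −(−1)^ξ s/√2 (ξ ∈ {0,1}), for every time t ∈ ℕ and every (x,y) ∈ ℤ² the amplitudes satisfy: |s|·α_{x−1,y,0}(t) + |c|·α_{x−1,y,1}(t) + |c|·α_{x+1,y,2}(t) + |s|·α_{x+1,y,3}(t) = 0 and |s|·α_{x,y−1,0}(t) + |c|·α_{x,y−1,2}(t) + |c|·α_{x,y+1,1}(t) + |s|·α_{x,y+1,3}(t) = 0. -/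
/-- The generalized Grover coin with parameters `c = cos γ`, `s = sin γ`. -/
noncomputable def genGroverCoin (c s : ℝ) : Fin 4 → Fin 4 → ℝ :=
  ![![-c^2, |c*s|, |c*s|, s^2],
    ![|c*s|, -s^2, c^2, |c*s|],
    ![|c*s|, c^2, -s^2, |c*s|],
    ![s^2, |c*s|, |c*s|, -c^2]]

/-- One-step evolution of the generalized Grover walk on `ℤ²`. -/
def GenGroverEvol (c s : ℝ) (α : ℕ → ℤ → ℤ → Fin 4 → ℝ) : Prop :=
  ∀ (t : ℕ) (x y : ℤ),
    α (t+1) x y 0 = ∑ j : Fin 4, genGroverCoin c s 0 j * α t (x+1) (y+1) j ∧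
    α (t+1) x y 1 = ∑ j : Fin 4, genGroverCoin c s 1 j * α t (x+1) (y-1) j ∧
    α (t+1) x y 2 = ∑ j : Fin 4, genGroverCoin c s 2 j * α t (x-1) (y+1) j ∧
    α (t+1) x y 3 = ∑ j : Fin 4, genGroverCoin c s 3 j * α t (x-1) (y-1) j

/-- One-step evolution of the generalized alternate walk on `ℤ²` with coin
`U = ((c, s), (s, -c))`. -/
def GenAltEvol (c s : ℝ) (β : ℕ → ℤ → ℤ → Fin 2 → ℂ) : Prop :=
  ∀ (t : ℕ) (x y : ℤ),
    β (t+1) x y 0 = (c : ℂ) * ((c : ℂ) * β t (x+1) (y+1) 0 + (s : ℂ) * β t (x+1) (y+1) 1)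
      + (s : ℂ) * ((s : ℂ) * β t (x-1) (y+1) 0 - (c : ℂ) * β t (x-1) (y+1) 1) ∧
    β (t+1) x y 1 = (s : ℂ) * ((c : ℂ) * β t (x+1) (y-1) 0 + (s : ℂ) * β t (x+1) (y-1) 1)
      - (c : ℂ) * ((s : ℂ) * β t (x-1) (y-1) 0 - (c : ℂ) * β t (x-1) (y-1) 1)

/-- The pair of relations satisfied by a configuration `f` of coin amplitudes on `ℤ²`. -/
def GroverRelations (a b : ℝ) (f : ℤ → ℤ → Fin 4 → ℝ) : Prop :=
  ∀ x y : ℤ,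
    a * f (x-1) y 0 + b * f (x-1) y 1 + b * f (x+1) y 2 + a * f (x+1) y 3 = 0 ∧
    a * f x (y-1) 0 + b * f x (y-1) 2 + b * f x (y+1) 1 + a * f x (y+1) 3 = 0

/-- One step of the generalized Grover walk exchanges the two relations. -/
theorem GenGroverEvol.groverRelations_succ {c s : ℝ} (hcs : c ^ 2 + s ^ 2 = 1)
    {α : ℕ → ℤ → ℤ → Fin 4 → ℝ} (hevol : GenGroverEvol c s α) {t : ℕ}
    (h : GroverRelations |s| |c| (α t)) : GroverRelations |s| |c| (α (t+1)) := by
  intro x y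
  obtain ⟨hx, hy⟩ := h x y
  have hab : |c| ^ 2 + |s| ^ 2 = 1 := by simpa only [sq_abs] using hcs
  rw [(hevol t (x-1) y).1, (hevol t (x-1) y).2.1, (hevol t (x+1) y).2.2.1,
    (hevol t (x+1) y).2.2.2, (hevol t x (y-1)).1, (hevol t x (y-1)).2.2.1,
    (hevol t x (y+1)).2.1, (hevol t x (y+1)).2.2.2]
  simp only [genGroverCoin, Fin.sum_univ_four, Matrix.cons_val, sub_add_cancel,
    add_sub_cancel_right, abs_mul, ← sq_abs c, ← sq_abs s]
  constructor
  · linear_combination hy + (|c| * α t x (y+1) 1 + |s| * α t x (y+1) 3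
      + |s| * α t x (y-1) 0 + |c| * α t x (y-1) 2) * hab
  · linear_combination hx + (|s| * α t (x-1) y 0 + |c| * α t (x-1) y 1
      + |c| * α t (x+1) y 2 + |s| * α t (x+1) y 3) * hab

/-- If `a q₀ + b q₁ = 0`, `q₀ = q₃` and `q₁ = q₂` hold at every site, then so do the
relations. -/
theorem groverRelations_of_symmetric {a b : ℝ} {f : ℤ → ℤ → Fin 4 → ℝ}
    (h : ∀ x y, a * f x y 0 + b * f x y 1 = 0)
    (h03 : ∀ x y, f x y 0 = f x y 3) (h12 : ∀ x y, f x y 1 = f x y 2) :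
    GroverRelations a b f := by
  intro x y
  constructor
  · linear_combination h (x-1) y + h (x+1) y - a * h03 (x+1) y - b * h12 (x+1) y
  · linear_combination h x (y-1) + h x (y+1) - b * h12 x (y-1) - a * h03 x (y+1)

/-- Generalized amplitude relations for the generalized Grover walk started at the origin
with initial coin `q₀ = q₃ = (-1)^ξ |cs|/(√2 s)`, `q₁ = q₂ = -(-1)^ξ s/√2`. -/
theorem gen_grover_amplitude_relations
    (γ c s : ℝ) (hc : c = Real.cos γ) (hs : s = Real.sin γ) (hcs : c * s ≠ 0)
    (ξ : ℕ) (hξ : ξ = 0 ∨ ξ = 1)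
    (α : ℕ → ℤ → ℤ → Fin 4 → ℝ)
    (hevol : GenGroverEvol c s α)
    (hinit : ∀ (x y : ℤ), (x, y) ≠ (0, 0) → ∀ j, α 0 x y j = 0)
    (h0 : α 0 0 0 0 = (-1)^ξ * |c*s| / (Real.sqrt 2 * s))
    (h1 : α 0 0 0 1 = -((-1)^ξ * s / Real.sqrt 2))
    (h2 : α 0 0 0 2 = -((-1)^ξ * s / Real.sqrt 2))
    (h3 : α 0 0 0 3 = (-1)^ξ * |c*s| / (Real.sqrt 2 * s)) :
    ∀ (t : ℕ) (x y : ℤ),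
      |s| * α t (x-1) y 0 + |c| * α t (x-1) y 1
        + |c| * α t (x+1) y 2 + |s| * α t (x+1) y 3 = 0 ∧
      |s| * α t x (y-1) 0 + |c| * α t x (y-1) 2
        + |c| * α t x (y+1) 1 + |s| * α t x (y+1) 3 = 0 := by
  have hsq : c ^ 2 + s ^ 2 = 1 := by rw [hc, hs, Real.cos_sq_add_sin_sq]
  have hs0 : s ≠ 0 := right_ne_zero_of_mul hcs
  have horigin : |s| * α 0 0 0 0 + |c| * α 0 0 0 1 = 0 := by
    rw [h0, h1, abs_mul]
    field_simp
    linear_combination |c| * (-1) ^ ξ * sq_abs s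
  have hzero : GroverRelations |s| |c| (α 0) := by
    apply groverRelations_of_symmetric <;> intro x y <;> by_cases hxy : (x, y) = (0, 0)
    · obtain ⟨rfl, rfl⟩ := Prod.mk.inj hxy
      exact horigin
    · simp [hinit x y hxy]
    · obtain ⟨rfl, rfl⟩ := Prod.mk.inj hxy
      rw [h0, h3]
    · simp [hinit x y hxy]
    · obtain ⟨rfl, rfl⟩ := Prod.mk.inj hxy
      rw [h1, h2]
    · simp [hinit x y hxy]
  intro t
  induction t with
  | zero => exact hzero
  | succ t ih => exact hevol.groverRelations_succ hsq ih
end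

section
/- Fix γ with c = cos γ, s = sin γ. For all k_x, k_y ∈ ℝ, the 2×2 matrix V(k_x,k_y) = R(k_y)·U·R(k_x)·U, where R(k) = diag(e^{ik}, e^{−ik}) and U = ((c, s), (s, −c)), satisfies det V(k_x,k_y) = 1 and trace V(k_x,k_y) = 2[c²cos(k_x+k_y) + s²cos(k_x−k_y)]. Consequently, writing g₂ := c²cos(k_x+k_y) + s²cos(k_x−k_y) (which satisfies |g₂| ≤ 1), the eigenvalues of V(k_x,k_y) are exactly λ_± = g₂ ± i√(1 − g₂²), i.e., the characteristic polynomial of V(k_x,k_y) is λ² − 2g₂λ + 1. -/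
open Matrix

/-- The single-qubit coin `U = ((c, s), (s, -c))` viewed as a complex matrix. -/
noncomputable def coinU (c s : ℝ) : Matrix (Fin 2) (Fin 2) ℂ :=
  !![(c : ℂ), (s : ℂ); (s : ℂ), -(c : ℂ)]

/-- The shift matrix in Fourier space, `R(k) = diag(e^{ik}, e^{-ik})`. -/
noncomputable def shiftR (k : ℝ) : Matrix (Fin 2) (Fin 2) ℂ :=
  !![Complex.exp (Complex.I * k), 0; 0, Complex.exp (-(Complex.I * k))]

/-- The one-step Fourier-space evolution operator `V(kx, ky) = R(ky) U R(kx) U`. -/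
noncomputable def evolV (c s kx ky : ℝ) : Matrix (Fin 2) (Fin 2) ℂ :=
  shiftR ky * coinU c s * shiftR kx * coinU c s

/-- The shift matrix has determinant `1`. -/
theorem det_shiftR (k : ℝ) : (shiftR k).det = 1 := by
  simp [shiftR, Matrix.det_fin_two, ← Complex.exp_add]

/-- The determinant of the coin. -/
theorem det_coinU (c s : ℝ) : (coinU c s).det = -((c : ℂ) ^ 2 + (s : ℂ) ^ 2) := by
  simp only [coinU, Matrix.det_fin_two_of]
  ring

theorem det_evolV {c s : ℝ} (h : c ^ 2 + s ^ 2 = 1) (kx ky : ℝ) :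
    (evolV c s kx ky).det = 1 := by
  have h' : (c : ℂ) ^ 2 + (s : ℂ) ^ 2 = 1 := by exact_mod_cast h
  simp [evolV, Matrix.det_mul, det_shiftR, det_coinU, h']

theorem trace_evolV (c s kx ky : ℝ) :
    (evolV c s kx ky).trace =
      2 * ((c ^ 2 * Real.cos (kx + ky) + s ^ 2 * Real.cos (kx - ky) : ℝ) : ℂ) := by
  have e₁ : Complex.exp (-((kx + ky : ℂ)) * Complex.I) =
      Complex.exp (-(Complex.I * kx)) * Complex.exp (-(Complex.I * ky)) := by
    rw [← Complex.exp_add]; ring_nf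
  have e₂ : Complex.exp ((kx + ky : ℂ) * Complex.I) =
      Complex.exp (Complex.I * kx) * Complex.exp (Complex.I * ky) := by
    rw [← Complex.exp_add]; ring_nf
  have e₃ : Complex.exp (-((kx - ky : ℂ)) * Complex.I) =
      Complex.exp (-(Complex.I * kx)) * Complex.exp (Complex.I * ky) := by
    rw [← Complex.exp_add]; ring_nf
  have e₄ : Complex.exp ((kx - ky : ℂ) * Complex.I) =
      Complex.exp (Complex.I * kx) * Complex.exp (-(Complex.I * ky)) := by
    rw [← Complex.exp_add]; ring_nf
  push_cast
  rw [Complex.cos, Complex.cos, e₁, e₂, e₃, e₄]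
  simp only [evolV, shiftR, coinU, Matrix.mul_fin_two, Matrix.trace_fin_two_of]
  ring

/-- A convex combination of two cosines has absolute value at most `1`. -/
theorem abs_sq_mul_cos_add_sq_mul_cos_le_one {c s : ℝ} (h : c ^ 2 + s ^ 2 = 1) (a b : ℝ) :
    |c ^ 2 * Real.cos a + s ^ 2 * Real.cos b| ≤ 1 := by
  rw [abs_le]
  constructor <;>
    nlinarith [mul_le_mul_of_nonneg_left (Real.cos_le_one a) (sq_nonneg c),
      mul_le_mul_of_nonneg_left (Real.cos_le_one b) (sq_nonneg s),
      mul_le_mul_of_nonneg_left (Real.neg_one_le_cos a) (sq_nonneg c),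
      mul_le_mul_of_nonneg_left (Real.neg_one_le_cos b) (sq_nonneg s)]

/-- `V(kx, ky)` has determinant `1`, trace `2 g₂` with
`g₂ = c² cos(kx+ky) + s² cos(kx-ky)` (and `|g₂| ≤ 1`); hence its characteristic polynomial is
`λ² - 2 g₂ λ + 1`, i.e. its eigenvalues are exactly `g₂ ± i √(1 - g₂²)`. -/
theorem evolV_det_trace_charpoly
    (γ c s : ℝ) (hc : c = Real.cos γ) (hs : s = Real.sin γ)
    (kx ky : ℝ) (g₂ : ℝ)
    (hg₂ : g₂ = c^2 * Real.cos (kx + ky) + s^2 * Real.cos (kx - ky)) :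
    (evolV c s kx ky).det = 1 ∧
    (evolV c s kx ky).trace = 2 * (g₂ : ℂ) ∧
    |g₂| ≤ 1 ∧
    (evolV c s kx ky).charpoly
      = Polynomial.X ^ 2 - Polynomial.C (2 * (g₂ : ℂ)) * Polynomial.X + 1 ∧
    spectrum ℂ (evolV c s kx ky)
      = {(g₂ : ℂ) + Complex.I * Real.sqrt (1 - g₂^2),
         (g₂ : ℂ) - Complex.I * Real.sqrt (1 - g₂^2)} := by
  have h : c ^ 2 + s ^ 2 = 1 := by rw [hc, hs]; exact Real.cos_sq_add_sin_sq γ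
  have hdet := det_evolV h kx ky
  have htr : (evolV c s kx ky).trace = 2 * (g₂ : ℂ) := by rw [trace_evolV, hg₂]
  have habs : |g₂| ≤ 1 := hg₂ ▸ abs_sq_mul_cos_add_sq_mul_cos_le_one h _ _
  have hchar : (evolV c s kx ky).charpoly
      = Polynomial.X ^ 2 - Polynomial.C (2 * (g₂ : ℂ)) * Polynomial.X + 1 := by
    rw [Matrix.charpoly_fin_two, hdet, htr, Polynomial.C_1]
  refine ⟨hdet, htr, habs, hchar, ?_⟩
  have hsqrt : ((Real.sqrt (1 - g₂ ^ 2) : ℝ) : ℂ) ^ 2 = 1 - (g₂ : ℂ) ^ 2 := by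
    have := Real.sq_sqrt (sub_nonneg.mpr ((sq_le_one_iff_abs_le_one g₂).mpr habs))
    exact_mod_cast this
  ext z
  rw [Matrix.mem_spectrum_iff_isRoot_charpoly, hchar, Set.mem_insert_iff, Set.mem_singleton_iff,
    ← sub_eq_zero (a := z), ← sub_eq_zero (a := z), ← mul_eq_zero]
  simp only [Polynomial.IsRoot.def, Polynomial.eval_add, Polynomial.eval_sub, Polynomial.eval_pow,
    Polynomial.eval_X, Polynomial.eval_mul, Polynomial.eval_C, Polynomial.eval_one]
  refine Eq.congr_left ?_
  linear_combination -hsqrt + (Real.sqrt (1 - g₂ ^ 2) : ℂ) ^ 2 * Complex.I_sq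
end

section
/- Fix γ with c = cos γ, s = sin γ. For all k_x, k_y ∈ ℝ and j ∈ {1,2}, set g₁ := −c²sin(k_x+k_y) + s²sin(k_x−k_y), g₂ := c²cos(k_x+k_y) + s²cos(k_x−k_y), λ_j := g₂ + (−1)^j i√(1 − g₂²), and let v_j ∈ ℂ² be the vector with components v_j(0) = cs(e^{i(k_x+k_y)} − e^{−i(k_x−k_y)}) and v_j(1) = i[g₁ + (−1)^j √(1 − g₂²)]. Then V(k_x,k_y)·v_j = λ_j·v_j, where V(k_x,k_y) = R(k_y)·U·R(k_x)·U with R(k) = diag(e^{ik}, e^{−ik}) and U = ((c, s), (s, −c)). -/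
open Matrix

theorem Matrix.mulVec_eq_smul_of_trace_of_det {R : Type*} [CommRing R]
    (M : Matrix (Fin 2) (Fin 2) R) (l : R) (h : l ^ 2 - M.trace * l + M.det = 0) :
    M.mulVec ![M 0 1, l - M 0 0] = l • ![M 0 1, l - M 0 0] := by
  rw [Matrix.trace_fin_two, Matrix.det_fin_two] at h
  ext i
  fin_cases i
  · simp [Matrix.mulVec, dotProduct, Fin.sum_univ_two]
    ring
  · simp [Matrix.mulVec, dotProduct, Fin.sum_univ_two]
    linear_combination -h

theorem evolV_zero_zero (c s kx ky : ℝ) :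
    evolV c s kx ky 0 0 =
      ((c ^ 2 * Real.cos (kx + ky) + s ^ 2 * Real.cos (kx - ky) : ℝ) : ℂ) -
        Complex.I * ((-(c ^ 2 * Real.sin (kx + ky)) + s ^ 2 * Real.sin (kx - ky) : ℝ) : ℂ) := by
  simp [evolV, coinU, shiftR, Matrix.mul_apply, Fin.sum_univ_two, mul_comm Complex.I,
    Complex.exp_mul_I, ← neg_mul, Complex.cos_add, Complex.sin_add, Complex.cos_sub,
    Complex.sin_sub]
  linear_combination (c ^ 2 - s ^ 2 : ℂ) * Complex.sin kx * Complex.sin ky * Complex.I_sq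

theorem evolV_one_one (c s kx ky : ℝ) :
    evolV c s kx ky 1 1 =
      ((c ^ 2 * Real.cos (kx + ky) + s ^ 2 * Real.cos (kx - ky) : ℝ) : ℂ) +
        Complex.I * ((-(c ^ 2 * Real.sin (kx + ky)) + s ^ 2 * Real.sin (kx - ky) : ℝ) : ℂ) := by
  simp [evolV, coinU, shiftR, Matrix.mul_apply, Fin.sum_univ_two, mul_comm Complex.I,
    Complex.exp_mul_I, ← neg_mul, Complex.cos_add, Complex.sin_add, Complex.cos_sub,
    Complex.sin_sub]
  linear_combination (c ^ 2 - s ^ 2 : ℂ) * Complex.sin kx * Complex.sin ky * Complex.I_sq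

theorem evolV_zero_one (c s kx ky : ℝ) :
    evolV c s kx ky 0 1 = (c : ℂ) * (s : ℂ)
      * (Complex.exp (Complex.I * (kx + ky)) - Complex.exp (-(Complex.I * (kx - ky)))) := by
  have h₁ : Complex.I * ((kx : ℂ) + ky) = Complex.I * kx + Complex.I * ky := by ring
  have h₂ : -(Complex.I * ((kx : ℂ) - ky)) = -(Complex.I * kx) + Complex.I * ky := by ring
  rw [h₁, h₂, Complex.exp_add, Complex.exp_add]
  simp [evolV, coinU, shiftR, Matrix.mul_apply, Fin.sum_univ_two]
  ring

theorem sq_convexCombination_cos_le_one {c s : ℝ} (h : c ^ 2 + s ^ 2 = 1) (a b : ℝ) :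
    (c ^ 2 * Real.cos a + s ^ 2 * Real.cos b) ^ 2 ≤ 1 := by
  have hc := sq_nonneg c
  have hs := sq_nonneg s
  rw [sq_le_one_iff_abs_le_one, abs_le]
  constructor <;>
    nlinarith [mul_le_mul_of_nonneg_left (Real.cos_le_one a) hc,
      mul_le_mul_of_nonneg_left (Real.cos_le_one b) hs,
      mul_le_mul_of_nonneg_left (Real.neg_one_le_cos a) hc,
      mul_le_mul_of_nonneg_left (Real.neg_one_le_cos b) hs]

/-- The vector `v_j = (cs (e^{i(kx+ky)} - e^{-i(kx-ky)}), i (g₁ + (-1)^j √(1-g₂²)))` is an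
eigenvector of `V(kx, ky)` with eigenvalue `λ_j = g₂ + (-1)^j i √(1-g₂²)`, for `j ∈ {1,2}`. -/
theorem evolV_eigenvector
    (γ c s : ℝ) (hc : c = Real.cos γ) (hs : s = Real.sin γ)
    (kx ky : ℝ) (j : ℕ) (hj : j = 1 ∨ j = 2)
    (g₁ g₂ : ℝ)
    (hg₁ : g₁ = -(c^2 * Real.sin (kx + ky)) + s^2 * Real.sin (kx - ky))
    (hg₂ : g₂ = c^2 * Real.cos (kx + ky) + s^2 * Real.cos (kx - ky))
    (lam : ℂ) (hlam : lam = (g₂ : ℂ) + (-1 : ℂ)^j * Complex.I * Real.sqrt (1 - g₂^2))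
    (v : Fin 2 → ℂ)
    (hv : v = ![(c : ℂ) * (s : ℂ)
        * (Complex.exp (Complex.I * (kx + ky)) - Complex.exp (-(Complex.I * (kx - ky)))),
      Complex.I * ((g₁ : ℂ) + (-1 : ℂ)^j * (Real.sqrt (1 - g₂^2) : ℂ))]) :
    (evolV c s kx ky).mulVec v = lam • v := by
  have hcs : c ^ 2 + s ^ 2 = 1 := by rw [hc, hs, Real.cos_sq_add_sin_sq]
  have hsqrt : (Real.sqrt (1 - g₂ ^ 2) : ℂ) ^ 2 = 1 - (g₂ : ℂ) ^ 2 := by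
    have hle : 0 ≤ 1 - g₂ ^ 2 := by
      rw [hg₂]
      exact sub_nonneg.2 (sq_convexCombination_cos_le_one hcs _ _)
    exact_mod_cast Real.sq_sqrt hle
  have hsign : ((-1 : ℂ) ^ j) ^ 2 = 1 := by
    rcases hj with rfl | rfl <;> norm_num
  have h₀₀ := evolV_zero_zero c s kx ky
  have h₁₁ := evolV_one_one c s kx ky
  rw [← hg₁, ← hg₂] at h₀₀ h₁₁
  have hv' : v = ![evolV c s kx ky 0 1, lam - evolV c s kx ky 0 0] := by
    rw [hv, hlam, h₀₀, evolV_zero_one]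
    congr 2
    ring
  rw [hv']
  apply Matrix.mulVec_eq_smul_of_trace_of_det
  rw [det_evolV hcs, Matrix.trace_fin_two, h₀₀, h₁₁, hlam]
  linear_combination ((-1 : ℂ) ^ j) ^ 2 * (Real.sqrt (1 - g₂ ^ 2) : ℂ) ^ 2 * Complex.I_sq
    - (Real.sqrt (1 - g₂ ^ 2) : ℂ) ^ 2 * hsign - hsqrt
end

section
/- For the coupled induction step of the equivalence theorem: let α be Grover walk amplitudes and β be alternate (Hadamard) walk amplitudes (both evolving by their respective one-step recurrences), and fix a time t. Assume that for all (x,y) ∈ ℤ²: (i) β_{x,y,0}(t) = (−1)^t e^{iπ/4}[α_{x,y,0}(t) + i·α_{x,y,2}(t)] and β_{x,y,1}(t) = (−1)^t e^{iπ/4}[−α_{x,y,1}(t) + i·α_{x,y,3}(t)], and (ii) α_{x−1,y,0}(t) + α_{x−1,y,1}(t) + α_{x+1,y,2}(t) + α_{x+1,y,3}(t) = 0 and α_{x,y−1,0}(t) + α_{x,y−1,2}(t) + α_{x,y+1,1}(t) + α_{x,y+1,3}(t) = 0. Then for all (x,y) ∈ ℤ²: β_{x,y,0}(t+1) = (−1)^{t+1}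 e^{iπ/4}[α_{x,y,0}(t+1) + i·α_{x,y,2}(t+1)] and β_{x,y,1}(t+1) = (−1)^{t+1} e^{iπ/4}[−α_{x,y,1}(t+1) + i·α_{x,y,3}(t+1)]. -/
/-- The coupled inductive step of the equivalence theorem: if at time `t` the amplitude map
between the alternate (Hadamard) walk and the Grover walk holds together with the two Grover
amplitude relations, then the amplitude map holds at time `t+1`. -/
theorem alternate_grover_inductive_step
    (α : ℕ → ℤ → ℤ → Fin 4 → ℝ)
    (hαevol : GroverEvol α)
    (β : ℕ → ℤ → ℤ → Fin 2 → ℂ)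
    (hβevol : AltEvol β)
    (t : ℕ)
    (hmap : ∀ (x y : ℤ),
      β t x y 0 = (-1 : ℂ)^t * Complex.exp (Real.pi * Complex.I / 4)
        * ((α t x y 0 : ℂ) + Complex.I * (α t x y 2 : ℂ)) ∧
      β t x y 1 = (-1 : ℂ)^t * Complex.exp (Real.pi * Complex.I / 4)
        * (-(α t x y 1 : ℂ) + Complex.I * (α t x y 3 : ℂ)))
    (hrel1 : ∀ (x y : ℤ),
      α t (x-1) y 0 + α t (x-1) y 1 + α t (x+1) y 2 + α t (x+1) y 3 = 0)
    (hrel2 : ∀ (x y : ℤ),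
      α t x (y-1) 0 + α t x (y-1) 2 + α t x (y+1) 1 + α t x (y+1) 3 = 0) :
    ∀ (x y : ℤ),
      β (t+1) x y 0 = (-1 : ℂ)^(t+1) * Complex.exp (Real.pi * Complex.I / 4)
        * ((α (t+1) x y 0 : ℂ) + Complex.I * (α (t+1) x y 2 : ℂ)) ∧
      β (t+1) x y 1 = (-1 : ℂ)^(t+1) * Complex.exp (Real.pi * Complex.I / 4)
        * (-(α (t+1) x y 1 : ℂ) + Complex.I * (α (t+1) x y 3 : ℂ)) := by
  intro x y
  obtain ⟨b0, b1⟩ := hβevol t x y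
  obtain ⟨a0, a1, a2, a3⟩ := hαevol t x y
  have hUp : (α t (x-1) (y+1) 0 : ℂ) + α t (x-1) (y+1) 1 + α t (x+1) (y+1) 2
      + α t (x+1) (y+1) 3 = 0 := by exact_mod_cast hrel1 x (y+1)
  have hDown : (α t (x-1) (y-1) 0 : ℂ) + α t (x-1) (y-1) 1 + α t (x+1) (y-1) 2
      + α t (x+1) (y-1) 3 = 0 := by exact_mod_cast hrel1 x (y-1)
  simp only [Fin.sum_univ_four, groverCoin, Fin.reduceEq, if_true, if_false] at a0 a1 a2 a3
  constructor
  · rw [b0, a0, a2, (hmap _ _).1, (hmap _ _).2, (hmap _ _).1, (hmap _ _).2]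
    push_cast
    linear_combination
      (-1 : ℂ)^t * Complex.exp (Real.pi * Complex.I / 4) / 2 * (1 + Complex.I) * hUp
  · rw [b1, a1, a3, (hmap _ _).1, (hmap _ _).2, (hmap _ _).1, (hmap _ _).2]
    push_cast
    linear_combination
      (-1 : ℂ)^t * Complex.exp (Real.pi * Complex.I / 4) / 2 * (Complex.I - 1) * hDown
end
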